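/- arXiv:2203.14070 — 2 statements merged into one kernel-verified Lean document; each statement's English description precedes it below -/
import Mathlib

section
/- The BPMSTP instance with M = 3 machines, K = 10 time slots, and N = 4 jobs with processing times p_1 = 2, p_2 = p_3 = 9, p_4 = 10 admits no schedule at all (hence no feasible schedule), even though ∑_{j} p_j = 30 = M·K and the makespan lower bound K̲(I) = max{⌊∑_j p_j/M⌋, max_j p_j} equals K = 10; in particular the lower bound K̲(I) is not tight. -/
/-- A BPMSTP instance: `N` jobs with processing times `p j` (`1 ≤ p j ≤ K`),
`M` machines with energy consumption rates `u h ≥ 0`, and a time horizon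
`{1, …, K}` of time slots with costs `c t ≥ 0`. -/
structure BInstance where
  N : ℕ
  M : ℕ
  K : ℕ
  hN : 0 < N
  hM : 0 < M
  hK : 0 < K
  p : Fin N → ℕ
  hp : ∀ j, 1 ≤ p j ∧ p j ≤ K
  u : Fin M → ℝ
  hu : ∀ h, 0 ≤ u h
  c : ℕ → ℝ
  hc : ∀ t, 0 ≤ c t

/-- A schedule assigns each job a machine and a set of `p j` time slots,
with jobs on the same machine using disjoint slot sets. -/
structure Schedule (I : BInstance) where
  mach : Fin I.N → Fin I.M
  slots : Fin I.N → Finset ℕ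
  slots_subset : ∀ j, slots j ⊆ Finset.Icc 1 I.K
  slots_card : ∀ j, (slots j).card = I.p j
  disj : ∀ j j', j ≠ j' → mach j = mach j' → Disjoint (slots j) (slots j')

namespace Schedule

variable {I : BInstance}

/-- A schedule is feasible if every job occupies consecutive time slots. -/
def Feasible (S : Schedule I) : Prop :=
  ∀ j, ∃ s, S.slots j = Finset.Ico s (s + I.p j)

/-- The makespan: the largest slot used by any job. -/
def Cmax (S : Schedule I) : ℕ :=
  Finset.univ.sup fun j => (S.slots j).sup id

/-- The total energy cost. -/
def TEC (S : Schedule I) : ℝ :=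
  ∑ j, I.u (S.mach j) * ∑ t ∈ S.slots j, I.c t

/-- Two schedules are equivalent if they have the same makespan and the same TEC. -/
def Equivalent (S S' : Schedule I) : Prop :=
  S.Cmax = S'.Cmax ∧ S.TEC = S'.TEC

theorem slots_nonempty (S : Schedule I) (j : Fin I.N) : (S.slots j).Nonempty := by
  rw [← Finset.card_pos, S.slots_card]
  exact (I.hp j).1

/-- Slot `t` is occupied on machine `h`: some job assigned to `h` contains `t`. -/
def Occupied (S : Schedule I) (h : Fin I.M) (t : ℕ) : Prop :=
  ∃ j, S.mach j = h ∧ t ∈ S.slots j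

/-- A split-schedule: for every job `j`, every slot between `min (T j)` and
`max (T j)` is occupied on the machine of `j`. -/
def IsSplit (S : Schedule I) : Prop :=
  ∀ j t, (S.slots j).min' (S.slots_nonempty j) ≤ t →
    t ≤ (S.slots j).max' (S.slots_nonempty j) → S.Occupied (S.mach j) t

/-- `S` dominates `S'`. -/
def Dominates (S S' : Schedule I) : Prop :=
  S.Cmax ≤ S'.Cmax ∧ S.TEC ≤ S'.TEC ∧ (S.Cmax < S'.Cmax ∨ S.TEC < S'.TEC)

end Schedule

/-- The set of distinct processing times. -/
def PJ (I : BInstance) : Finset ℕ := Finset.univ.image I.p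

/-- The set of jobs with processing time `d`. -/
def Jd (I : BInstance) (d : ℕ) : Finset (Fin I.N) := Finset.univ.filter fun j => I.p j = d

/-- The makespan lower bound `max { ⌊(∑ p j) / M⌋, max p j }`. -/
def Klb (I : BInstance) : ℕ := max ((∑ j, I.p j) / I.M) (Finset.univ.sup I.p)

/-- `bcost I d t = ∑_{k=t}^{t+d-1} c k`, the cumulative cost of `d` slots from `t`. -/
def bcost (I : BInstance) (d t : ℕ) : ℝ := ∑ k ∈ Finset.Icc t (t + d - 1), I.c k

/-- The instance with `M = 3`, `K = 10`, and processing times `2, 9, 9, 10`. -/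
def inst9 : BInstance where
  N := 4
  M := 3
  K := 10
  hN := by norm_num
  hM := by norm_num
  hK := by norm_num
  p := ![2, 9, 9, 10]
  hp := by decide
  u := fun _ => 1
  hu := fun _ => zero_le_one
  c := fun _ => 1
  hc := fun _ => zero_le_one

/-- The instance with `M = 3`, `K = 10` and processing times
`2, 9, 9, 10` admits no schedule at all, even though `∑ p j = M·K` and the
makespan lower bound `K̲(I)` equals `K`. -/
theorem statement9 :
    IsEmpty (Schedule inst9) ∧
    ∑ j, inst9.p j = inst9.M * inst9.K ∧
    Klb inst9 = inst9.K := by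
  refine ⟨⟨fun S => ?_⟩, by decide, by decide⟩
  have hp : ∀ i j : Fin inst9.N, i ≠ j → inst9.K < inst9.p i + inst9.p j := by decide
  have hlt : Fintype.card (Fin inst9.M) < Fintype.card (Fin inst9.N) := by
    rw [Fintype.card_fin, Fintype.card_fin]; decide
  obtain ⟨i, j, hij, hm⟩ := Fintype.exists_ne_map_eq_of_card_lt S.mach hlt
  have hc := Finset.card_union_of_disjoint (S.disj i j hij hm)
  have hs := Finset.card_le_card (Finset.union_subset (S.slots_subset i) (S.slots_subset j))
  rw [hc, S.slots_card, S.slots_card, Nat.card_Icc] at hs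
  have := hp i j hij
  omega
end

section
/- Let y : P_J × H × T → {0, 1} satisfy: (i) for each d ∈ P_J, ∑_{h ∈ H} ∑_{t=1}^{K−d+1} y(d, h, t) = |J_d|, and y(d, h, t) = 0 whenever t > K − d + 1; (ii) for each h ∈ H and t ∈ T, ∑_{d ∈ P_J} ∑_{i = max{1, t−d+1}}^{t} y(d, h, i) ≤ 1. Then there exists a feasible schedule S of the instance with E(S) = ∑_{h ∈ H} u_h ∑_{d ∈ P_J} ∑_{t=1}^{K−d+1} b_{d,t}·y(d, h, t), where b_{d,t} = ∑_{k=t}^{t+d−1} c_k, and C_max(S) = max{t + d − 1 : y(d, h, t) = 1}. -/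
/-- The start pairs (machine, slot) selected by `y` for processing time `d`. -/
def startSet (I : BInstance) (y : ℕ → Fin I.M → ℕ → ℕ) (d : ℕ) : Finset (Fin I.M × ℕ) :=
  ((Finset.univ : Finset (Fin I.M)) ×ˢ Finset.Icc 1 (I.K - d + 1)).filter
    fun x => y d x.1 x.2 = 1

theorem exists_assign (I : BInstance) (y : ℕ → Fin I.M → ℕ → ℕ)
    (hbin : ∀ d h t, y d h t ≤ 1)
    (hcount : ∀ d ∈ PJ I,
      ∑ h : Fin I.M, ∑ t ∈ Finset.Icc 1 (I.K - d + 1), y d h t = (Jd I d).card) :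
    ∃ f : Fin I.N → Fin I.M × ℕ,
      (∀ j, f j ∈ startSet I y (I.p j)) ∧
      (∀ j j', I.p j = I.p j' → f j = f j' → j = j') ∧
      (∀ d ∈ PJ I, ∀ x ∈ startSet I y d, ∃ j, I.p j = d ∧ f j = x) := by
  have hcard : ∀ d ∈ PJ I, (Jd I d).card = (startSet I y d).card := by
    intro d hd
    rw [← hcount d hd, startSet, Finset.card_filter, Finset.sum_product]
    refine Finset.sum_congr rfl fun h _ => Finset.sum_congr rfl fun t _ => ?_
    have := hbin d h t
    split_ifs with hy
    · exact hy
    · change ¬ y d h t = 1 at hy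
      change y d h t = 0
      omega
  have key : ∀ d ∈ PJ I, ∃ g : Fin I.N → Fin I.M × ℕ,
      (∀ j, I.p j = d → g j ∈ startSet I y d) ∧
      (∀ j j', I.p j = d → I.p j' = d → g j = g j' → j = j') ∧
      (∀ x ∈ startSet I y d, ∃ j, I.p j = d ∧ g j = x) := by
    intro d hd
    let e := Finset.equivOfCardEq (hcard d hd)
    have hm : ∀ j, j ∈ Jd I d ↔ I.p j = d := by intro j; simp [Jd]
    refine ⟨fun j => if h : I.p j = d then (e ⟨j, (hm j).2 h⟩).1 else (⟨0, I.hM⟩, 0), ?_, ?_, ?_⟩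
    · intro j hj
      simp only [hj, dite_true]
      exact (e _).2
    · intro j j' hj hj' h
      simp only [hj, hj', dite_true] at h
      have := e.injective (Subtype.ext h)
      exact congrArg Subtype.val this
    · intro x hx
      have h := (hm _).1 (e.symm ⟨x, hx⟩).2
      refine ⟨(e.symm ⟨x, hx⟩).1, h, ?_⟩
      simp [h]
  haveI : Nonempty (Fin I.M) := ⟨⟨0, I.hM⟩⟩
  choose! g h1 h2 h3 using key
  have hP : ∀ j, I.p j ∈ PJ I := fun j => Finset.mem_image_of_mem _ (Finset.mem_univ j)
  refine ⟨fun j => g (I.p j) j, fun j => h1 _ (hP j) j rfl, ?_, ?_⟩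
  · intro j j' hp h
    simp only [← hp] at h
    exact h2 _ (hP j) j j' rfl hp.symm h
  · intro d hd x hx
    obtain ⟨j, rfl, h⟩ := h3 d hd x hx
    exact ⟨j, rfl, h⟩

/-- every 0/1 assignment `y` satisfying the constraints of
Formulation 2 yields a feasible schedule whose TEC and makespan are given by
the corresponding expressions in `y`. -/
theorem statement13 (I : BInstance) (y : ℕ → Fin I.M → ℕ → ℕ)
    (hbin : ∀ d h t, y d h t ≤ 1)
    (hdom : ∀ d h t, y d h t = 1 → d ∈ PJ I ∧ t ∈ Finset.Icc 1 (I.K - d + 1))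
    (hcount : ∀ d ∈ PJ I,
      ∑ h : Fin I.M, ∑ t ∈ Finset.Icc 1 (I.K - d + 1), y d h t = (Jd I d).card)
    (hover : ∀ h : Fin I.M, ∀ t ∈ Finset.Icc 1 I.K,
      ∑ d ∈ PJ I, ∑ i ∈ Finset.Icc (max 1 (t - d + 1)) t, y d h i ≤ 1) :
    ∃ S : Schedule I, S.Feasible ∧
      S.TEC = ∑ h : Fin I.M, I.u h * ∑ d ∈ PJ I, ∑ t ∈ Finset.Icc 1 (I.K - d + 1),
        bcost I d t * (y d h t : ℝ) ∧
      S.Cmax = ((PJ I) ×ˢ (Finset.univ : Finset (Fin I.M)) ×ˢ Finset.Icc 1 I.K).sup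
        (fun x => if y x.1 x.2.1 x.2.2 = 1 then x.2.2 + x.1 - 1 else 0) := by
  obtain ⟨f, hf, hinj, hsurj⟩ := exists_assign I y hbin hcount
  have hP : ∀ j, I.p j ∈ PJ I := fun j => Finset.mem_image_of_mem _ (Finset.mem_univ j)
  have hf' : ∀ j, y (I.p j) (f j).1 (f j).2 = 1 ∧ 1 ≤ (f j).2 ∧
      (f j).2 ≤ I.K - I.p j + 1 := by
    intro j
    have := hf j
    simp only [startSet, Finset.mem_filter, Finset.mem_product, Finset.mem_univ, true_and,
      Finset.mem_Icc] at this
    tauto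
  have hdisj : ∀ j j', j ≠ j' → (f j).1 = (f j').1 →
      Disjoint (Finset.Ico (f j).2 ((f j).2 + I.p j))
        (Finset.Ico (f j').2 ((f j').2 + I.p j')) := by
    intro j j' hne hm
    rw [Finset.disjoint_left]
    intro t ht ht'
    rw [Finset.mem_Ico] at ht ht'
    obtain ⟨a1, a2, a3⟩ := hf' j
    obtain ⟨b1, b2, b3⟩ := hf' j'
    have hpj := I.hp j
    have hpj' := I.hp j'
    have ho := hover (f j).1 t (Finset.mem_Icc.2 (by omega))
    rw [Finset.sum_sigma'] at ho
    have hne2 : (⟨I.p j, (f j).2⟩ : (_ : ℕ) × ℕ) ≠ ⟨I.p j', (f j').2⟩ := by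
      intro h
      simp only [Sigma.mk.injEq, heq_eq_eq] at h
      exact hne (hinj j j' h.1 (Prod.ext hm h.2))
    have hsub : ({⟨I.p j, (f j).2⟩, ⟨I.p j', (f j').2⟩} : Finset ((_ : ℕ) × ℕ)) ⊆
        (PJ I).sigma fun d => Finset.Icc (max 1 (t - d + 1)) t := by
      intro x hx
      simp only [Finset.mem_insert, Finset.mem_singleton] at hx
      rcases hx with rfl | rfl
      · simp only [Finset.mem_sigma, Finset.mem_Icc, hP, true_and]
        omega
      · simp only [Finset.mem_sigma, Finset.mem_Icc, hP, true_and]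
        omega
    have hle := Finset.sum_le_sum_of_subset (f := fun x : (_ : ℕ) × ℕ => y x.1 (f j).1 x.2) hsub
    rw [Finset.sum_pair hne2] at hle
    simp only [] at hle
    rw [a1, hm, b1] at hle
    rw [hm] at ho
    omega
  refine ⟨⟨fun j => (f j).1, fun j => Finset.Ico (f j).2 ((f j).2 + I.p j), ?_, ?_, hdisj⟩,
    fun j => ⟨_, rfl⟩, ?_, ?_⟩
  · intro j t ht
    have := hf' j
    have := I.hp j
    simp only [Finset.mem_Ico, Finset.mem_Icc] at *
    omega
  · intro j
    simp
  · simp only [Schedule.TEC]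
    have hb : ∀ j, ∑ t ∈ Finset.Ico (f j).2 ((f j).2 + I.p j), I.c t
        = bcost I (I.p j) (f j).2 := by
      intro j
      rw [bcost]
      congr 1
      ext t
      have := I.hp j
      simp only [Finset.mem_Ico, Finset.mem_Icc]
      omega
    simp only [hb]
    rw [← Finset.sum_fiberwise_of_maps_to (s := Finset.univ) (t := PJ I) (g := I.p)
      (fun j _ => hP j)]
    simp only [Finset.mul_sum]
    rw [Finset.sum_comm]
    refine Finset.sum_congr rfl fun d hd => ?_
    rw [← Finset.sum_product' (f := fun h t => I.u h * (bcost I d t * (y d h t : ℝ)))]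
    have : ∑ x ∈ (Finset.univ : Finset (Fin I.M)) ×ˢ Finset.Icc 1 (I.K - d + 1),
        I.u x.1 * (bcost I d x.2 * (y d x.1 x.2 : ℝ))
        = ∑ x ∈ startSet I y d, I.u x.1 * bcost I d x.2 := by
      rw [startSet, Finset.sum_filter]
      refine Finset.sum_congr rfl fun x _ => ?_
      have := hbin d x.1 x.2
      split_ifs with h
      · simp [h]
      · have h0 : y d x.1 x.2 = 0 := by omega
        simp [h0]
    rw [this]
    refine Finset.sum_bij (fun j _ => f j) ?_ ?_ ?_ ?_
    · intro j hj
      have := (Finset.mem_filter.1 hj).2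
      exact this ▸ hf j
    · intro j hj j' hj' h
      exact hinj j j' ((Finset.mem_filter.1 hj).2.trans (Finset.mem_filter.1 hj').2.symm) h
    · intro x hx
      obtain ⟨j, h, h'⟩ := hsurj d hd x hx
      exact ⟨j, by simp [h], h'⟩
    · intro j hj
      rw [(Finset.mem_filter.1 hj).2]
  · simp only [Schedule.Cmax]
    apply le_antisymm
    · refine Finset.sup_le fun j _ => Finset.sup_le fun t ht => ?_
      obtain ⟨a1, a2, a3⟩ := hf' j
      have hpj := I.hp j
      rw [Finset.mem_Ico] at ht
      refine le_trans ?_ (Finset.le_sup (b := (I.p j, (f j).1, (f j).2)) ?_)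
      · simp only [a1, if_true, id]
        omega
      · simp only [Finset.mem_product, hP, Finset.mem_univ, true_and, Finset.mem_Icc]
        omega
    · refine Finset.sup_le fun x _ => ?_
      split_ifs with h
      · obtain ⟨hd, ht⟩ := hdom _ _ _ h
        obtain ⟨j, h1, h2⟩ := hsurj x.1 hd x.2 (by
          simp only [startSet, Finset.mem_filter, Finset.mem_product, Finset.mem_univ, true_and]
          exact ⟨ht, h⟩)
        have hpj := I.hp j
        refine le_trans ?_ (Finset.le_sup (Finset.mem_univ j))
        refine Finset.le_sup (f := id) (b := x.2.2 + x.1 - 1) ?_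
        rw [Finset.mem_Ico, h2, h1]
        omega
      · exact Nat.zero_le _
end
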